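/- For every integer N and all y, z ∈ K, the bilinear difference equation holds: y·φ_{N+1}(y/q,z/q)·φ_N(y,z) + z·φ_{N+1}(y,z)·φ_N(y/q,z/q) = (y + z)·φ_{N+1}(y/q,z)·φ_N(y,z/q). -/

import Mathlib

open Matrix Finset

/-- The Jacobi--Trudi type determinant: `det (p (n - 2i + j) y z)_{0 ≤ i,j ≤ n-1}`. -/
noncomputable def phiAux {K : Type*} [Field K] (p : ℤ → K → K → K) (n : ℕ) (y z : K) : K :=
  Matrix.det (Matrix.of fun i j : Fin n => p ((n : ℤ) - 2 * ((i : ℕ) : ℤ) + ((j : ℕ) : ℤ)) y z)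

/-- The polynomials `φ_N(y,z)`: for `N ≥ 0` the Jacobi--Trudi determinant (with `φ_0 = 1`
as the empty determinant), and for `N < 0` we set `φ_N = (-1)^(N(N+1)/2) φ_(-N-1)`. -/
noncomputable def phi {K : Type*} [Field K] (p : ℤ → K → K → K) (N : ℤ) (y z : K) : K :=
  if 0 ≤ N then phiAux p N.toNat y z
  else (-1 : K) ^ (N * (N + 1) / 2) * phiAux p (-N - 1).toNat y z

/-- The determinant of a matrix is unchanged when a multiple of the next row is added
to each row. -/
theorem det_eq_of_forall_row_eq_smul_add_succ {K : Type*} [Field K] {n : ℕ}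
    {A B : Matrix (Fin (n + 1)) (Fin (n + 1)) K} (c : K)
    (hlast : ∀ j, A (Fin.last n) j = B (Fin.last n) j)
    (hcast : ∀ (i : Fin n) j, A i.castSucc j = B i.castSucc j + c * A i.succ j) :
    A.det = B.det := by
  rw [← Matrix.det_submatrix_equiv_self Fin.revPerm A,
    ← Matrix.det_submatrix_equiv_self Fin.revPerm B]
  refine Matrix.det_eq_of_forall_row_eq_smul_add_pred (fun _ => c) ?_ ?_
  · intro j
    simpa using hlast _
  · intro i j
    simpa [Fin.rev_succ, Fin.rev_castSucc] using hcast i.rev j.rev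

/-- The determinant `det (s (n - 2i + j))` attached to a sequence `s`. -/
noncomputable def staircaseDet {K : Type*} [Field K] (s : ℤ → K) (n : ℕ) : K :=
  Matrix.det (Matrix.of fun i j : Fin n => s ((n : ℤ) - 2 * ((i : ℕ) : ℤ) + ((j : ℕ) : ℤ)))

/-- Multiplying the generating function of a sequence by an even factor does not change its
staircase determinants. -/
theorem staircaseDet_sub_shift_two {K : Type*} [Field K] {s r : ℤ → K} (c : K)
    (hs : ∀ k < 0, s k = 0) (hr : ∀ k, r k = s k - c * s (k - 2)) (n : ℕ) :
    staircaseDet r n = staircaseDet s n := by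
  cases n with
  | zero => simp [staircaseDet]
  | succ n =>
    refine (det_eq_of_forall_row_eq_smul_add_succ c ?_ ?_).symm
    · intro j
      have hj := j.2
      simp only [Matrix.of_apply, hr, Fin.val_last]
      rw [hs (_ - 2) (by push_cast; omega)]
      ring
    · intro i j
      simp only [Matrix.of_apply, hr, Fin.val_castSucc, Fin.val_succ]
      push_cast
      ring_nf

/-- The column `(s (n + 1 - 2i + m))_i`. -/
def shiftedColumn {K : Type*} (n : ℕ) (s : ℤ → K) (m : ℤ) : Fin (n + 2) → K :=
  fun i => s ((n : ℤ) + 1 - 2 * ((i : ℕ) : ℤ) + m)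

theorem staircaseDet_succ_succ {K : Type*} [Field K] (s : ℤ → K) (n : ℕ) :
    staircaseDet s (n + 2)
      = Matrix.det (Matrix.of fun j : Fin (n + 2) => shiftedColumn n s (1 + (j : ℕ))) := by
  rw [staircaseDet, ← Matrix.det_transpose]
  congr 1
  ext i j
  simp only [Matrix.transpose_apply, Matrix.of_apply, shiftedColumn]
  congr 1
  push_cast
  ring

theorem staircaseDet_succ {K : Type*} [Field K] {s : ℤ → K}
    (hs : ∀ k < 0, s k = 0) (hs0 : s 0 = 1) (n : ℕ) :
    staircaseDet s (n + 1)
      = Matrix.det (Matrix.of fun j : Fin (n + 2) => shiftedColumn n s (0 + (j : ℕ))) := by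
  rw [← Matrix.det_transpose, Matrix.det_succ_row _ (Fin.last (n + 1)), Fin.sum_univ_castSucc,
    Finset.sum_eq_zero]
  · simp only [Matrix.transpose_apply, Matrix.of_apply, shiftedColumn, Fin.val_last,
      Fin.succAbove_last, staircaseDet]
    rw [show ((n : ℤ) + 1 - 2 * ((n + 1 : ℕ) : ℤ) + (0 + ((n + 1 : ℕ) : ℤ))) = 0 by
      push_cast; ring, hs0, Even.neg_one_pow ⟨n + 1, rfl⟩]
    simp only [zero_add, one_mul]
    congr 1
  · intro j _
    have hj := j.2
    simp only [Matrix.transpose_apply, Matrix.of_apply, shiftedColumn, Fin.val_last,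
      Fin.val_castSucc]
    rw [hs _ (by push_cast; omega)]
    simp

/-- If `v m = u m + b * v (m - 1)`, then all columns but the first one in a determinant of
consecutive shifts of `v` can be replaced by those of `u`. -/
theorem det_shiftedColumn {K : Type*} [Field K] {u v : ℤ → K} (b : K)
    (huv : ∀ k, v k = u k + b * v (k - 1)) (n : ℕ) (e : ℤ) :
    Matrix.det (Matrix.of fun j : Fin (n + 2) => shiftedColumn n v (e + (j : ℕ)))
      = Matrix.detRowAlternating (Matrix.vecCons (shiftedColumn n v e)
          fun j : Fin (n + 1) => shiftedColumn n u (e + 1 + (j : ℕ))) := by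
  refine Matrix.det_eq_of_forall_row_eq_smul_add_pred (fun _ => b) ?_ ?_
  · intro i
    simp [Matrix.vecCons]
  · intro j i
    simp only [Matrix.of_apply, Matrix.cons_val_succ, shiftedColumn, Fin.val_succ,
      Fin.val_castSucc]
    rw [huv]
    push_cast
    ring_nf

/-- A three-term Plücker relation. -/
theorem det_mul_apply_of_vanishing {K : Type*} [Field K] {n : ℕ} (U : Fin n → Fin (n + 2) → K)
    (l : (Fin (n + 2) → K) →ₗ[K] K) (hl : ∀ k, l (U k) = 0) (v y u : Fin (n + 2) → K) :
    Matrix.detRowAlternating (Matrix.vecCons v (Matrix.vecCons y U)) * l u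
      = Matrix.detRowAlternating (Matrix.vecCons u (Matrix.vecCons y U)) * l v
        + Matrix.detRowAlternating (Matrix.vecCons v (Matrix.vecCons u U)) * l y := by
  set M : Matrix (Fin (n + 2)) (Fin (n + 2)) K :=
    Matrix.of (Matrix.vecCons v (Matrix.vecCons y U)) with hM
  have hc := Matrix.mulVec_cramer Mᵀ u
  rw [Matrix.mulVec_transpose, Matrix.vecMul_eq_sum, Matrix.det_transpose] at hc
  have h := congrArg l hc
  rw [map_sum, map_smul, Fin.sum_univ_succ, Fin.sum_univ_succ, Finset.sum_eq_zero] at h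
  · simp only [map_smul, Matrix.cramer_transpose_apply, smul_eq_mul] at h
    have h0 : M.updateRow 0 u = Matrix.of (Matrix.vecCons u (Matrix.vecCons y U)) := by
      ext i j
      refine Fin.cases ?_ (fun i => ?_) i <;> simp [hM, Matrix.updateRow_apply]
    have h1 : M.updateRow (Fin.succ 0) u = Matrix.of (Matrix.vecCons v (Matrix.vecCons u U)) := by
      ext i j
      refine Fin.cases ?_ (fun i => ?_) i
      · simp [hM, Matrix.updateRow_apply]
      · refine Fin.cases ?_ (fun i => ?_) i <;> simp [hM, Matrix.updateRow_apply, Fin.ext_iff]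
    rw [h0, h1, add_zero] at h
    exact h.symm
  · intro k _
    rw [map_smul, show M k.succ.succ = U k from rfl, hl, smul_zero]

/-- If `v = (1 + aT) x` and `u = (1 - bT) v`, where `T` is the shift, all columns but the first
two in a determinant of consecutive shifts of `x` can be replaced by those of `u`. -/
theorem det_shiftedColumn_two {K : Type*} [Field K] {x v u : ℤ → K} (a b : K)
    (hv : ∀ k, v k = x k + a * x (k - 1)) (hu : ∀ k, u k = v k - b * v (k - 1)) (n : ℕ) :
    Matrix.det (Matrix.of fun j : Fin (n + 2) => shiftedColumn n x (0 + (j : ℕ)))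
      = Matrix.detRowAlternating (Matrix.vecCons (shiftedColumn n x 0)
          (Matrix.vecCons (shiftedColumn n v 1)
            fun j : Fin n => shiftedColumn n u (2 + (j : ℕ)))) := by
  rw [det_shiftedColumn (u := v) (-a) (fun k => by rw [hv]; ring)]
  refine Matrix.det_eq_of_forall_row_eq_smul_add_pred (Fin.cons 0 fun _ => b) ?_ ?_
  · intro i
    simp
  · intro j i
    refine Fin.cases ?_ (fun j => ?_) j
    · simp
    · rw [← Fin.succ_castSucc]
      simp only [Matrix.cons_val_succ, Fin.cons_succ, shiftedColumn, Fin.val_succ,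
        Fin.val_castSucc]
      rw [hu]
      push_cast
      ring_nf

theorem staircaseDet_bilinear_of_sequence {K : Type*} [Field K] {x v y u : ℤ → K} (a b : K)
    (hx : ∀ k < 0, x k = 0) (hx0 : x 0 = 1)
    (hv : ∀ k, v k = x k + a * x (k - 1)) (hy : ∀ k, y k = x k - b * x (k - 1))
    (hu : ∀ k, u k = v k - b * v (k - 1)) (n : ℕ) :
    a * staircaseDet v (n + 1) * staircaseDet y n + b * staircaseDet y (n + 1) * staircaseDet v n
      = (a + b) * staircaseDet u (n + 1) * staircaseDet x n := by
  cases n with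
  | zero =>
    simp [staircaseDet, hu, hv, hy, hx, hx0]
    ring
  | succ n =>
    have hv' : ∀ k < 0, v k = 0 := fun k hk => by
      rw [hv, hx k hk, hx (k - 1) (by omega)]; ring
    have hy' : ∀ k < 0, y k = 0 := fun k hk => by
      rw [hy, hx k hk, hx (k - 1) (by omega)]; ring
    have hv0 : v 0 = 1 := by rw [hv, hx0, hx _ (by norm_num)]; ring
    have hy0 : y 0 = 1 := by rw [hy, hx0, hx _ (by norm_num)]; ring
    have huv : ∀ k, v k = u k + b * v (k - 1) := fun k => by rw [hu]; ring
    have huy : ∀ k, y k = u k + (-a) * y (k - 1) := fun k => by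
      rw [hu, hv, hv, hy, hy]; ring
    rw [staircaseDet_succ_succ, staircaseDet_succ_succ, staircaseDet_succ_succ,
      staircaseDet_succ hv' hv0, staircaseDet_succ hy' hy0, staircaseDet_succ hx hx0,
      det_shiftedColumn b huv, det_shiftedColumn b huv, det_shiftedColumn _ huy,
      det_shiftedColumn _ huy, det_shiftedColumn_two a b hv hu,
      det_shiftedColumn (u := u) (v := u) 0 (fun k => by ring)]
    set U : Fin n → Fin (n + 2) → K := fun j => shiftedColumn n u (2 + (j : ℕ)) with hU
    have hcons : (fun j : Fin (n + 1) => shiftedColumn n u (0 + 1 + (j : ℕ)))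
        = Matrix.vecCons (shiftedColumn n u 1) U := by
      funext j
      refine Fin.cases (by simp) (fun j => ?_) j
      simp only [Matrix.cons_val_succ, hU, Fin.val_succ]
      congr 1
      push_cast
      ring
    rw [hcons]
    set E : Fin (n + 1) → Fin (n + 2) → K := fun j => shiftedColumn n u (1 + 1 + (j : ℕ)) with hE
    let D : (Fin (n + 2) → K) [⋀^Fin (n + 2)]→ₗ[K] K := Matrix.detRowAlternating
    let l : (Fin (n + 2) → K) →ₗ[K] K :=
      { toFun := fun α => D.curryLeft α E
        map_add' := fun α β => by simp
        map_smul' := fun c α => by simp }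
    have hl : ∀ k, l (U k) = 0 := fun k => by
      refine D.map_eq_zero_of_eq _ (i := 0) (j := k.castSucc.succ) ?_ (Fin.succ_ne_zero _).symm
      simp [hU, hE]
    have key := det_mul_apply_of_vanishing U l hl (shiftedColumn n v 1) (shiftedColumn n y 1)
      (shiftedColumn n u 1)
    let F : (Fin (n + 2) → K) → (Fin (n + 2) → K) → K := fun α β =>
      (D.curryLeft α).curryLeft β U
    have F_add : ∀ α α' β c, F (α + c • α') β = F α β + c * F α' β := fun α α' β c => by
      simp only [F, map_add, map_smul, AlternatingMap.curryLeft_add, AlternatingMap.curryLeft_smul,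
        LinearMap.add_apply, LinearMap.smul_apply, AlternatingMap.add_apply,
        AlternatingMap.smul_apply, smul_eq_mul]
    have F_add' : ∀ α β β' c, F α (β + c • β') = F α β + c * F α β' := fun α β β' c => by
      simp only [F, map_add, map_smul, AlternatingMap.add_apply, AlternatingMap.smul_apply,
        smul_eq_mul]
    have F_self : ∀ α, F α α = 0 := fun α => by
      simp only [F, AlternatingMap.curryLeft_same, AlternatingMap.zero_apply]
    have F_swap : ∀ α β, F β α = - F α β := fun α β => by
      have h := F_self (α + (1 : K) • β)
      rw [F_add, F_add', F_add', F_self, F_self] at h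
      linear_combination h
    have e1 : shiftedColumn n v 1 = shiftedColumn n u 1 + b • shiftedColumn n v 0 := by
      funext i
      simp only [shiftedColumn, Pi.add_apply, Pi.smul_apply, smul_eq_mul]
      rw [huv]
      ring_nf
    have e2 : shiftedColumn n y 1 = shiftedColumn n u 1 + (-a) • shiftedColumn n y 0 := by
      funext i
      simp only [shiftedColumn, Pi.add_apply, Pi.smul_apply, smul_eq_mul]
      rw [huy]
      ring_nf
    have e3 : shiftedColumn n y 1 = shiftedColumn n v 1 + (-(a + b)) • shiftedColumn n x 0 := by
      funext i
      simp only [shiftedColumn, Pi.add_apply, Pi.smul_apply, smul_eq_mul]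
      rw [hy, hv]
      ring_nf
    change F _ _ * l _ = F _ _ * l _ + F _ _ * l _ at key
    change a * l _ * F _ _ + b * l _ * F _ _ = (a + b) * l _ * F _ _
    have f1 : F (shiftedColumn n v 1) (shiftedColumn n u 1)
        = b * F (shiftedColumn n v 0) (shiftedColumn n u 1) := by
      rw [e1, F_add, F_self, zero_add]
    have f2 : F (shiftedColumn n y 1) (shiftedColumn n u 1)
        = -a * F (shiftedColumn n y 0) (shiftedColumn n u 1) := by
      rw [e2, F_add, F_self, zero_add]
    have f3 : F (shiftedColumn n v 1) (shiftedColumn n y 1)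
        = (a + b) * F (shiftedColumn n x 0) (shiftedColumn n v 1) := by
      rw [e3, F_add', F_self, F_swap (shiftedColumn n x 0)]
      ring
    rw [f1, f3, F_swap (shiftedColumn n y 1), f2] at key
    linear_combination -key

/-- A sequence with vanishing negative part can be divided by `1 + aT`, with `T` the shift. -/
theorem exists_shift_quotient {K : Type*} [Field K] (a : K) {h : ℤ → K}
    (hh : ∀ k < 0, h k = 0) :
    ∃ x : ℤ → K, (∀ k < 0, x k = 0) ∧ ∀ k, h k = x k + a * x (k - 1) := by
  let X : ℕ → K := fun n => Nat.rec (h 0) (fun m r => h (m + 1) - a * r) n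
  refine ⟨fun k => if k < 0 then 0 else X k.toNat, fun k hk => by simp [hk], fun k => ?_⟩
  rcases lt_trichotomy k 0 with hk | rfl | hk
  · simp [hk, hh k hk, show k - 1 < 0 by omega]
  · simp [X]
  · obtain ⟨m, rfl⟩ : ∃ m : ℕ, k = m + 1 := ⟨(k - 1).toNat, by omega⟩
    have h1 : ((m : ℤ) + 1).toNat = m + 1 := by omega
    have h2 : ¬ ((m : ℤ) + 1 < 0) := by omega
    simp [h1, h2, show ¬ ((m : ℤ) < 0) by omega, X]

/-- The bilinear relation for staircase determinants of an arbitrary sequence `h`, with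
`f = (1 - aT) h`, `g = (1 - bT) h` and `w = (1 - aT) (1 - bT) h`, where `T` is the shift. -/
theorem staircaseDet_bilinear {K : Type*} [Field K] {h f g w : ℤ → K} (a b : K)
    (hh : ∀ k < 0, h k = 0) (hh0 : h 0 = 1)
    (hf : ∀ k, f k = h k - a * h (k - 1)) (hg : ∀ k, g k = h k - b * h (k - 1))
    (hw : ∀ k, w k = f k - b * f (k - 1)) (n : ℕ) :
    a * staircaseDet h (n + 1) * staircaseDet w n + b * staircaseDet w (n + 1) * staircaseDet h n
      = (a + b) * staircaseDet g (n + 1) * staircaseDet f n := by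
  obtain ⟨x, hx, hxh⟩ := exists_shift_quotient a hh
  have hx0 : x 0 = 1 := by
    have := hxh 0
    rw [hx (0 - 1) (by norm_num), hh0] at this
    simpa using this.symm
  have hfx : ∀ k, f k = x k - a ^ 2 * x (k - 2) := fun k => by
    rw [hf, hxh, hxh, show k - 1 - 1 = k - 2 by ring]; ring
  have hwy : ∀ k, w k = (x k - b * x (k - 1)) - a ^ 2 * (x (k - 2) - b * x (k - 2 - 1)) :=
    fun k => by
      rw [hw, hfx, hfx, show k - 1 - 2 = k - 2 - 1 by ring]; ring
  have hy : ∀ k < 0, x k - b * x (k - 1) = 0 := fun k hk => by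
    rw [hx k hk, hx (k - 1) (by omega)]; ring
  rw [staircaseDet_sub_shift_two (s := x) _ hx hfx,
    staircaseDet_sub_shift_two (s := fun k => x k - b * x (k - 1)) _ hy hwy,
    staircaseDet_sub_shift_two (s := fun k => x k - b * x (k - 1)) _ hy hwy]
  exact staircaseDet_bilinear_of_sequence a b hx hx0 hxh (fun _ => rfl) hg n

theorem bilinear_bl4
    {K : Type*} [Field K] (q : K) (hq0 : q ≠ 0)
    (hq1 : ∀ k : ℕ, 1 ≤ k → q ^ k ≠ 1)
    (p : ℤ → K → K → K)
    (hp_neg : ∀ k : ℤ, k < 0 → ∀ y z : K, p k y z = 0)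
    (hp_zero : ∀ y z : K, p 0 y z = 1)
    (hC1 : ∀ k : ℕ, 1 ≤ k → ∀ y z : K,
      (∑ i ∈ Finset.range k, q ^ i) * p (k : ℤ) y z
        = (y + z + q ^ (k - 1)) * p ((k : ℤ) - 1) y z
          - (1 - q) * y * z * p ((k : ℤ) - 2) y z)
    (hC2 : ∀ (k : ℤ) (y z : K), p k y (q * z) - p k y z = (q - 1) * z * p (k - 1) y z)
    (hC3 : ∀ (k : ℤ) (y z : K), p k (q * y) z - p k y z = (q - 1) * y * p (k - 1) y z)
    (N : ℤ) (y z : K) :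
    y * phi p (N + 1) (y / q) (z / q) * phi p N y z
      + z * phi p (N + 1) y z * phi p N (y / q) (z / q)
    = (y + z) * phi p (N + 1) (y / q) z * phi p N y (z / q) := by
  have hq : 1 - q ≠ 0 := fun h => hq1 1 le_rfl (by linear_combination -h)
  have hy : q * (y / q) = y := mul_div_cancel₀ y hq0
  have hz : q * (z / q) = z := mul_div_cancel₀ z hq0
  have stepY : ∀ k z', p k y z'
      = p k (y / q) z' - (1 - q) * (y / q) * p (k - 1) (y / q) z' := fun k z' => by
    have := hC3 k (y / q) z'
    rw [hy] at this
    linear_combination this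
  have stepZ : ∀ k y', p k y' z
      = p k y' (z / q) - (1 - q) * (z / q) * p (k - 1) y' (z / q) := fun k y' => by
    have := hC2 k y' (z / q)
    rw [hz] at this
    linear_combination this
  have main := staircaseDet_bilinear (h := fun k => p k (y / q) (z / q))
    (f := fun k => p k y (z / q)) (g := fun k => p k (y / q) z) (w := fun k => p k y z)
    _ _ (fun k hk => hp_neg k hk _ _) (hp_zero _ _)
    (fun k => stepY k _) (fun k => stepZ k _) (fun k => stepZ k _)
  have main' := staircaseDet_bilinear (h := fun k => p k (y / q) (z / q))
    (f := fun k => p k (y / q) z) (g := fun k => p k y (z / q)) (w := fun k => p k y z)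
    _ _ (fun k hk => hp_neg k hk _ _) (hp_zero _ _)
    (fun k => stepZ k _) (fun k => stepY k _) (fun k => stepY k _)
  have hphi : ∀ (n : ℕ) (y' z' : K), phiAux p n y' z' = staircaseDet (fun k => p k y' z') n :=
    fun _ _ _ => rfl
  have phi_nat : ∀ (n : ℕ) (y' z' : K), phi p n y' z' = staircaseDet (fun k => p k y' z') n :=
    fun n y' z' => by simp [phi, hphi]
  have phi_neg : ∀ n : ℕ, ∃ c : K, ∀ y' z' : K,
      phi p (-n - 1) y' z' = c * staircaseDet (fun k => p k y' z') n := fun n =>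
    ⟨_, fun y' z' => by
      rw [phi, if_neg (by omega), hphi, show (-(-(n : ℤ) - 1) - 1).toNat = n by omega]⟩
  have hs : (1 - q) / q ≠ 0 := div_ne_zero hq hq0
  rcases lt_trichotomy N (-1) with hN | rfl | hN
  · obtain ⟨n, rfl⟩ : ∃ n : ℕ, N = -((n + 1 : ℕ) : ℤ) - 1 := ⟨(-N - 2).toNat, by omega⟩
    rw [show -((n + 1 : ℕ) : ℤ) - 1 + 1 = -(n : ℤ) - 1 by push_cast; ring]
    obtain ⟨c, hc⟩ := phi_neg n
    obtain ⟨d, hd⟩ := phi_neg (n + 1)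
    simp only [hc, hd]
    refine mul_left_cancel₀ hs ?_
    linear_combination c * d * main' n
  · simp [phi, phiAux]
  · obtain ⟨n, rfl⟩ : ∃ n : ℕ, N = n := ⟨N.toNat, by omega⟩
    rw [show (n : ℤ) + 1 = ((n + 1 : ℕ) : ℤ) by push_cast; rfl]
    simp only [phi_nat]
    refine mul_left_cancel₀ hs ?_
    linear_combination main n
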